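/- arXiv:2512.13357 — 5 statements merged into one kernel-verified Lean document; each statement's English description precedes it below -/
import Mathlib

section
/- For every integer k ≥ 1 and every real θ ∈ (0, π/4) satisfying sin(2θ) > 2^{1-k}·√(4^{k-1} − 1), setting δ = π/2 − 2θ, there exists a finite sequence α_1, …, α_k with each α_j ∈ (0,1) such that for every j with 1 ≤ j ≤ k, cos δ · sin 2θ · P_j + sin δ · α_j / 2^{j-1} + sin δ · cos 2θ · (1 − α_j) > 1, where P_j = ∏_{l=1}^{j-1} (2 − α_l)/2 (empty product equal to 1). -/
/-- The products `∏ (2 - ε A ^ (l - 1)) / 2` with `A = 1 + K` deviate from `1` by at most the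
corresponding geometric sum. -/
theorem mul_one_sub_prod_le {K ε : ℝ} (hK : 0 ≤ K) (hε : 0 ≤ ε) (n : ℕ)
    (h : ∀ l, 1 ≤ l → l ≤ n → ε * (1 + K) ^ (l - 1) ≤ 1) :
    K * (1 - ∏ l ∈ Finset.Icc 1 n, (2 - ε * (1 + K) ^ (l - 1)) / 2) ≤ ε * ((1 + K) ^ n - 1) := by
  induction n with
  | zero => simp
  | succ n ih =>
    have ih := ih fun l hl hln => h l hl (by lia)
    have hP : ∏ l ∈ Finset.Icc 1 n, (2 - ε * (1 + K) ^ (l - 1)) / 2 ≤ 1 := by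
      refine Finset.prod_le_one (fun l hl => ?_) fun l hl => ?_
      · have := h l (Finset.mem_Icc.1 hl).1 (by have := (Finset.mem_Icc.1 hl).2; lia)
        linarith
      · have : 0 ≤ ε * (1 + K) ^ (l - 1) := by positivity
        linarith
    rw [Finset.prod_Icc_succ_top (by lia), Nat.add_sub_cancel, pow_succ]
    set P := ∏ l ∈ Finset.Icc 1 n, (2 - ε * (1 + K) ^ (l - 1)) / 2
    have hα : 0 ≤ K * (ε * (1 + K) ^ n) := by positivity
    nlinarith [mul_le_mul_of_nonneg_left hP hα]

/-- The entanglement threshold on `sin x` bounds `cos x` from above. -/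
theorem cos_lt_of_threshold_lt_sin {k : ℕ} (hk : 1 ≤ k) {x : ℝ}
    (hC : (2 : ℝ) ^ ((1 : ℤ) - k) * Real.sqrt ((4 : ℝ) ^ ((k : ℤ) - 1) - 1) < Real.sin x) :
    Real.cos x < 1 / 2 ^ (k - 1) := by
  obtain ⟨m, rfl⟩ := Nat.exists_eq_add_of_le' hk
  have e1 : (1 : ℤ) - ((m + 1 : ℕ) : ℤ) = -(m : ℤ) := by push_cast; ring
  have e2 : ((m + 1 : ℕ) : ℤ) - 1 = (m : ℤ) := by push_cast; ring
  rw [e1, e2, zpow_neg, zpow_natCast, zpow_natCast] at hC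
  rw [Nat.add_sub_cancel]
  have h4 : (4 : ℝ) ^ m = (2 ^ m) ^ 2 := by rw [← pow_mul, mul_comm, pow_mul]; norm_num
  have h2 : (0 : ℝ) < 2 ^ m := by positivity
  have h1 : (1 : ℝ) ≤ 4 ^ m := one_le_pow₀ (by norm_num)
  have hsq := pow_lt_pow_left₀ hC (by positivity) two_ne_zero
  rw [mul_pow, Real.sq_sqrt (by linarith), h4, Real.sin_sq, inv_pow, mul_sub,
    inv_mul_cancel₀ (by positivity)] at hsq
  refine lt_of_pow_lt_pow_left₀ 2 (by positivity) ?_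
  rw [div_pow, one_pow, one_div]
  linarith


open Real Finset

/-- For every integer `k ≥ 1` and `θ ∈ (0, π/4)` with
`sin 2θ > 2^{1-k} √(4^{k-1} - 1)`, setting `δ = π/2 - 2θ`, there is a sequence
`α_1, …, α_k ∈ (0,1)` such that for all `1 ≤ j ≤ k`,
`cos δ · sin 2θ · P_j + sin δ · α_j / 2^{j-1} + sin δ · cos 2θ · (1 - α_j) > 1`,
where `P_j = ∏_{l=1}^{j-1} (2 - α_l)/2`. -/
theorem stmt0 (k : ℕ) (hk : 1 ≤ k) (θ : ℝ) (hθ : θ ∈ Set.Ioo 0 (π / 4))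
    (hC : Real.sin (2 * θ) > (2 : ℝ) ^ ((1 : ℤ) - k) * Real.sqrt ((4 : ℝ) ^ ((k : ℤ) - 1) - 1))
    (δ : ℝ) (hδ : δ = π / 2 - 2 * θ) :
    ∃ α : ℕ → ℝ, (∀ j, 1 ≤ j → j ≤ k → α j ∈ Set.Ioo (0 : ℝ) 1) ∧
      ∀ j, 1 ≤ j → j ≤ k →
        Real.cos δ * Real.sin (2 * θ) * (∏ l ∈ Finset.Icc 1 (j - 1), (2 - α l) / 2)
          + Real.sin δ * α j / 2 ^ (j - 1)
          + Real.sin δ * Real.cos (2 * θ) * (1 - α j) > 1 := by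
  have hs : 0 < Real.sin (2 * θ) := Real.sin_pos_of_pos_of_lt_pi (by linarith [hθ.1])
    (by linarith [hθ.2, Real.pi_pos])
  have hc : 0 < Real.cos (2 * θ) := Real.cos_pos_of_mem_Ioo
    ⟨by linarith [hθ.1, Real.pi_pos], by linarith [hθ.2]⟩
  have hcq := cos_lt_of_threshold_lt_sin hk hC
  have hsc := Real.sin_sq_add_cos_sq (2 * θ)
  rw [hδ, Real.cos_pi_div_two_sub, Real.sin_pi_div_two_sub]
  set s := Real.sin (2 * θ)
  set c := Real.cos (2 * θ)
  obtain ⟨d, hd⟩ : ∃ d, d = c * (1 / 2 ^ (k - 1) - c) := ⟨_, rfl⟩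
  have hd0 : 0 < d := hd ▸ mul_pos hc (sub_pos.2 hcq)
  obtain ⟨K, hK⟩ : ∃ K, K = s ^ 2 / d := ⟨_, rfl⟩
  have hK0 : 0 < K := hK ▸ by positivity
  have hKd : d * K = s ^ 2 := by rw [hK]; field_simp
  obtain ⟨ε, hε⟩ : ∃ ε, ε = 1 / (1 + K) ^ k := ⟨_, rfl⟩
  have hε0 : 0 < ε := hε ▸ by positivity
  have hlt : ∀ j, 1 ≤ j → j ≤ k → ε * (1 + K) ^ (j - 1) < 1 := by
    intro j hj hjk
    rw [hε, one_div_mul_eq_div, div_lt_one (by positivity)]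
    exact pow_lt_pow_right₀ (by linarith) (by lia)
  refine ⟨fun j => ε * (1 + K) ^ (j - 1), fun j hj hjk => ⟨by positivity, hlt j hj hjk⟩,
    fun j hj hjk => ?_⟩
  have hP := mul_one_sub_prod_le hK0.le hε0.le (j - 1)
    fun l hl hlj => (hlt l hl (by lia)).le
  have hα : 0 < ε * (1 + K) ^ (j - 1) := by positivity
  beta_reduce
  set P := ∏ l ∈ Finset.Icc 1 (j - 1), (2 - ε * (1 + K) ^ (l - 1)) / 2
  set a := ε * (1 + K) ^ (j - 1) with ha
  have hq : (1 : ℝ) / 2 ^ (k - 1) ≤ 1 / 2 ^ (j - 1) :=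
    one_div_le_one_div_of_le (by positivity) (pow_le_pow_right₀ (by norm_num) (by lia))
  have hloss : s ^ 2 * (1 - P) < d * a := by
    rw [← hKd, mul_assoc]
    exact mul_lt_mul_of_pos_left (by linarith) hd0
  have hgain : d * a ≤ c * (1 / 2 ^ (j - 1) - c) * a := by
    rw [hd]
    gcongr
  have hdiv : c * a / 2 ^ (j - 1) = c * a * (1 / 2 ^ (j - 1)) := by ring
  rw [hdiv]
  linarith
end

section
/- Let k ≥ 2 be an integer and δ ∈ (0, π/2) satisfy sin δ = 2^{1-k}. Then for any reals α_1, …, α_k with each α_j ∈ (0,1), writing P_k = ∏_{l=1}^{k-1} (2 − α_l)/2, one has cos²δ · P_k + sin δ · α_k / 2^{k-1} + sin²δ · (1 − α_k) = cos²δ · P_k + sin²δ < 1. -/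
open Real Finset

/-- Let `k ≥ 2` and `δ ∈ (0, π/2)` with `sin δ = 2^{1-k}`. For any
`α_1, …, α_k ∈ (0,1)`, with `P_k = ∏_{l=1}^{k-1} (2 - α_l)/2`, one has
`cos²δ·P_k + sin δ·α_k/2^{k-1} + sin²δ·(1 - α_k) = cos²δ·P_k + sin²δ < 1`. -/
theorem stmt3 (k : ℕ) (hk : 2 ≤ k) (δ : ℝ) (hδ : δ ∈ Set.Ioo 0 (π / 2))
    (hsin : Real.sin δ = (2 : ℝ) ^ ((1 : ℤ) - k))
    (α : ℕ → ℝ) (hα : ∀ j, 1 ≤ j → j ≤ k → α j ∈ Set.Ioo (0 : ℝ) 1) :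
    Real.cos δ ^ 2 * (∏ l ∈ Finset.Icc 1 (k - 1), (2 - α l) / 2)
        + Real.sin δ * α k / 2 ^ (k - 1) + Real.sin δ ^ 2 * (1 - α k)
      = Real.cos δ ^ 2 * (∏ l ∈ Finset.Icc 1 (k - 1), (2 - α l) / 2) + Real.sin δ ^ 2 ∧
    Real.cos δ ^ 2 * (∏ l ∈ Finset.Icc 1 (k - 1), (2 - α l) / 2) + Real.sin δ ^ 2 < 1 := by
  have hpow : Real.sin δ = 1 / 2 ^ (k - 1) := by
    obtain ⟨m, rfl⟩ : ∃ m, k = m + 1 := ⟨k - 1, by omega⟩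
    rw [hsin, show (1 : ℤ) - ((m + 1 : ℕ) : ℤ) = -(m : ℤ) by push_cast; ring]
    simp
  have hprod : ∏ l ∈ Finset.Icc 1 (k - 1), (2 - α l) / 2 < 1 := by
    have hα' : ∀ l ∈ Finset.Icc 1 (k - 1), α l ∈ Set.Ioo (0 : ℝ) 1 := fun l hl => by
      rw [Finset.mem_Icc] at hl
      exact hα l hl.1 (by omega)
    calc ∏ l ∈ Finset.Icc 1 (k - 1), (2 - α l) / 2
        < ∏ _l ∈ Finset.Icc 1 (k - 1), (1 : ℝ) :=
          Finset.prod_lt_prod_of_nonempty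
            (fun l hl => by linarith [(hα' l hl).2])
            (fun l hl => by linarith [(hα' l hl).1])
            (Finset.nonempty_Icc.2 (by omega))
      _ = 1 := Finset.prod_const_one
  have hcos : 0 < Real.cos δ := Real.cos_pos_of_mem_Ioo ⟨by linarith [hδ.1, hδ.2], hδ.2⟩
  constructor
  · have hterm : Real.sin δ * α k / 2 ^ (k - 1) = Real.sin δ ^ 2 * α k := by
      rw [hpow]
      ring
    rw [hterm]
    ring
  · linarith [mul_lt_mul_of_pos_left hprod (pow_pos hcos 2), Real.sin_sq_add_cos_sq δ]
end

section
/- Let k ≥ 2 be an integer and δ ∈ (0, π/2) satisfy sin δ = 2^{1-k}. Then there exists a finite sequence α_1, …, α_{k−1} with each α_j ∈ (0,1) such that for every j with 1 ≤ j ≤ k−1, cos²δ · P_j + sin δ · α_j / 2^{j-1} + sin²δ · (1 − α_j) > 1, where P_j = ∏_{l=1}^{j-1} (2 − α_l)/2 (empty product equal to 1). -/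
open Real Finset

/-- If `α l = r ^ (k - l)` with `0 < r ≤ 1 / 2`, the product of the factors `(2 - α l) / 2` differs
from `1` by at most `r` times the next term of the sequence. -/
theorem prod_two_sub_geom_bounds {r : ℝ} (hr : 0 < r) (hr2 : r ≤ 1 / 2) (k n : ℕ) (hn : n < k) :
    ∏ l ∈ Finset.Icc 1 n, (2 - r ^ (k - l)) / 2 ≤ 1 ∧
      1 - ∏ l ∈ Finset.Icc 1 n, (2 - r ^ (k - l)) / 2 ≤ r ^ (k - n) := by
  induction n with
  | zero => simpa using (pow_pos hr k).le
  | succ n ih =>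
    obtain ⟨h1, h2⟩ := ih (by omega)
    rw [Finset.prod_Icc_succ_top (by omega)]
    have hpow : r ^ (k - n) = r ^ (k - (n + 1)) * r := by
      rw [← pow_succ]
      congr 1
      omega
    rw [hpow] at h2
    have ha : 0 < r ^ (k - (n + 1)) := pow_pos hr _
    have ha1 : r ^ (k - (n + 1)) ≤ 1 := pow_le_one₀ hr.le (by linarith)
    generalize r ^ (k - (n + 1)) = a at *
    generalize ∏ l ∈ Finset.Icc 1 n, (2 - r ^ (k - l)) / 2 = p at *
    constructor <;> nlinarith [mul_nonneg ha.le (sub_nonneg.2 h1), mul_nonneg ha.le (sub_nonneg.2 hr2)]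

/-- Let `k ≥ 2` and `δ ∈ (0, π/2)` with `sin δ = 2^{1-k}`. Then there is
a sequence `α_1, …, α_{k-1} ∈ (0,1)` such that for all `1 ≤ j ≤ k-1`,
`cos²δ·P_j + sin δ·α_j/2^{j-1} + sin²δ·(1 - α_j) > 1`,
where `P_j = ∏_{l=1}^{j-1} (2 - α_l)/2`. -/
theorem stmt4 (k : ℕ) (hk : 2 ≤ k) (δ : ℝ) (hδ : δ ∈ Set.Ioo 0 (π / 2))
    (hsin : Real.sin δ = (2 : ℝ) ^ ((1 : ℤ) - k)) :
    ∃ α : ℕ → ℝ, (∀ j, 1 ≤ j → j ≤ k - 1 → α j ∈ Set.Ioo (0 : ℝ) 1) ∧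
      ∀ j, 1 ≤ j → j ≤ k - 1 →
        Real.cos δ ^ 2 * (∏ l ∈ Finset.Icc 1 (j - 1), (2 - α l) / 2)
          + Real.sin δ * α j / 2 ^ (j - 1)
          + Real.sin δ ^ 2 * (1 - α j) > 1 := by
  rw [Real.cos_sq']
  have hs : 0 < Real.sin δ := by rw [hsin]; positivity
  have hs1 : Real.sin δ ≤ 1 := Real.sin_le_one δ
  have hbound : ∀ j, 1 ≤ j → j ≤ k - 1 → 2 * Real.sin δ ≤ 1 / 2 ^ (j - 1) := by
    intro j hj hjk
    have : (2 : ℝ) * 2 ^ ((1 : ℤ) - k) = 2 ^ ((2 : ℤ) - k) := by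
      rw [← zpow_one_add₀ two_ne_zero]
      congr 1
      ring
    rw [hsin, this, one_div, ← zpow_natCast, ← zpow_neg]
    exact zpow_le_zpow_right₀ one_le_two (by omega)
  generalize Real.sin δ = s at *
  have hr : 0 < s ^ 2 / 2 := by positivity
  have hr2 : s ^ 2 / 2 ≤ 1 / 2 := by nlinarith
  refine ⟨fun j => (s ^ 2 / 2) ^ (k - j), fun j hj hjk => ⟨pow_pos hr _,
    pow_lt_one₀ hr.le (by linarith) (by omega)⟩, fun j hj hjk => ?_⟩
  obtain ⟨-, h2⟩ := prod_two_sub_geom_bounds hr hr2 k (j - 1) (by omega)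
  have hb := hbound j hj hjk
  have hpow : (s ^ 2 / 2) ^ (k - (j - 1)) = (s ^ 2 / 2) ^ (k - j) * (s ^ 2 / 2) := by
    rw [← pow_succ]
    congr 1
    omega
  rw [hpow] at h2
  have ha : 0 < (s ^ 2 / 2) ^ (k - j) := pow_pos hr _
  beta_reduce
  rw [mul_div_assoc, div_eq_mul_one_div (_ ^ (k - j)) ((2 : ℝ) ^ (j - 1))]
  generalize (s ^ 2 / 2) ^ (k - j) = a at *
  generalize ∏ l ∈ Finset.Icc 1 (j - 1), (2 - (s ^ 2 / 2) ^ (k - l)) / 2 = p at *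
  generalize 1 / (2 : ℝ) ^ (j - 1) = b at *
  have h3 : (1 - s ^ 2) * (1 - p) ≤ (1 - s ^ 2) * (a * (s ^ 2 / 2)) :=
    mul_le_mul_of_nonneg_left h2 (by linarith)
  have h4 : s * (a * (2 * s)) ≤ s * (a * b) := by gcongr
  have h5 : 0 < a * s ^ 2 := by positivity
  nlinarith [mul_pos h5 (pow_pos hs 2)]
end

section
/- Let k ≥ 2 and n ≥ 2 be integers and δ ∈ (0, π/2) satisfy sin δ = 2^{1-k}. Then there exists a finite sequence α_1, …, α_k with each α_j ∈ (0,1) such that for every j with 1 ≤ j ≤ k, (cos²δ + sin δ) · (cos²δ · P_j + sin δ · α_j / 2^{j-1} + sin²δ · (1 − α_j))^{n−1} > 1, where P_j = ∏_{l=1}^{j-1} (2 − α_l)/2 (empty product equal to 1). -/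
open Real Finset

/-- Let `k ≥ 2`, `n ≥ 2`, and `δ ∈ (0, π/2)` with `sin δ = 2^{1-k}`.
Then there is a sequence `α_1, …, α_k ∈ (0,1)` such that for all `1 ≤ j ≤ k`,
`(cos²δ + sin δ) · (cos²δ·P_j + sin δ·α_j/2^{j-1} + sin²δ·(1 - α_j))^{n-1} > 1`,
where `P_j = ∏_{l=1}^{j-1} (2 - α_l)/2`. -/
theorem stmt5 (k n : ℕ) (hk : 2 ≤ k) (hn : 2 ≤ n) (δ : ℝ) (hδ : δ ∈ Set.Ioo 0 (π / 2))
    (hsin : Real.sin δ = (2 : ℝ) ^ ((1 : ℤ) - k)) :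
    ∃ α : ℕ → ℝ, (∀ j, 1 ≤ j → j ≤ k → α j ∈ Set.Ioo (0 : ℝ) 1) ∧
      ∀ j, 1 ≤ j → j ≤ k →
        (Real.cos δ ^ 2 + Real.sin δ) *
          (Real.cos δ ^ 2 * (∏ l ∈ Finset.Icc 1 (j - 1), (2 - α l) / 2)
            + Real.sin δ * α j / 2 ^ (j - 1)
            + Real.sin δ ^ 2 * (1 - α j)) ^ (n - 1) > 1 := by
  have hpos : 0 < Real.sin δ := by rw [hsin]; positivity
  have hlt : Real.sin δ < 1 := by
    rw [hsin]
    exact zpow_lt_one_of_neg₀ (by norm_num) (by omega)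
  have hA : 1 < Real.cos δ ^ 2 + Real.sin δ := by
    nlinarith [Real.sin_sq_add_cos_sq δ]
  -- For a constant sequence `ε`, each expression tends to `cos²δ + sin δ > 1` as `ε → 0⁺`.
  have key : ∀ j ∈ Finset.Icc 1 k, ∀ᶠ ε : ℝ in nhdsWithin 0 (Set.Ioi 0),
      1 < (Real.cos δ ^ 2 + Real.sin δ) *
          (Real.cos δ ^ 2 * (∏ _l ∈ Finset.Icc 1 (j - 1), (2 - ε) / 2)
            + Real.sin δ * ε / 2 ^ (j - 1)
            + Real.sin δ ^ 2 * (1 - ε)) ^ (n - 1) := by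
    intro j _
    apply Filter.Eventually.filter_mono nhdsWithin_le_nhds
    refine ContinuousAt.eventually_lt continuousAt_const (Continuous.continuousAt ?_) ?_
    · fun_prop
    · simpa [Real.cos_sq_add_sin_sq] using hA
  obtain ⟨ε, hε, hε'⟩ := (((Filter.eventually_all_finset _).2 key).and
    (Ioo_mem_nhdsGT (zero_lt_one' ℝ))).exists
  exact ⟨fun _ => ε, fun _ _ _ => hε',
    fun j h1 h2 => hε j (Finset.mem_Icc.2 ⟨h1, h2⟩)⟩
end

section
/- Let δ ∈ (0, π/2), ε > 0, and let α_1 be a real with (1 − cos δ)/sin δ < α_1 < 2(1 − cos δ)/sin δ. Define recursively, for j ≥ 2, α_j = (1 + ε) · 2^{j-1} · (1 − cos δ · P_j) / sin δ, where P_j = ∏_{l=1}^{j-1} (2 − α_l)/2. Then α_2 > α_1; and moreover, for any j ≥ 3, if α_1, …, α_{j−1} all lie in (0, 2), then α_j > 2·α_{j−1}. -/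
open Real Finset

/-- Let `δ ∈ (0, π/2)`, `ε > 0`, and `(1 - cos δ)/sin δ < α_1 < 2(1 - cos δ)/sin δ`.
Define recursively `α_j = (1+ε)·2^{j-1}·(1 - cos δ · P_j)/sin δ` for `j ≥ 2`, where
`P_j = ∏_{l=1}^{j-1} (2 - α_l)/2`. Then `α_2 > α_1`; and for `j ≥ 3`, if `α_1, …, α_{j-1} ∈ (0,2)`,
then `α_j > 2·α_{j-1}`. -/
theorem stmt8 (δ ε : ℝ) (hδ : δ ∈ Set.Ioo 0 (π / 2)) (hε : 0 < ε) (α : ℕ → ℝ)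
    (hα1lo : (1 - Real.cos δ) / Real.sin δ < α 1)
    (hα1hi : α 1 < 2 * (1 - Real.cos δ) / Real.sin δ)
    (hrec : ∀ j, 2 ≤ j →
      α j = (1 + ε) * 2 ^ (j - 1) *
        (1 - Real.cos δ * ∏ l ∈ Finset.Icc 1 (j - 1), (2 - α l) / 2) / Real.sin δ) :
    α 2 > α 1 ∧
      ∀ j, 3 ≤ j → (∀ l, 1 ≤ l → l ≤ j - 1 → α l ∈ Set.Ioo (0 : ℝ) 2) →
        α j > 2 * α (j - 1) := by
  have hs : 0 < Real.sin δ := Real.sin_pos_of_pos_of_lt_pi hδ.1 (by linarith [hδ.2, Real.pi_pos])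
  have hc : 0 < Real.cos δ := Real.cos_pos_of_mem_Ioo ⟨by linarith [hδ.1, Real.pi_pos], hδ.2⟩
  have hα1 : 0 < α 1 :=
    (div_nonneg (sub_nonneg.2 (Real.cos_le_one δ)) hs.le).trans_lt hα1lo
  refine ⟨?_, fun j hj hmem => ?_⟩
  · refine hα1hi.trans ?_
    rw [hrec 2 le_rfl]
    apply div_lt_div_of_pos_right _ hs
    have hcα : 0 < Real.cos δ * α 1 := mul_pos hc hα1
    have hpos : 0 < 2 * (1 - Real.cos δ) + Real.cos δ * α 1 := by
      linarith [Real.cos_le_one δ]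
    have hprod : ∏ l ∈ Finset.Icc 1 (2 - 1), (2 - α l) / 2 = (2 - α 1) / 2 := by simp
    rw [hprod]
    linarith [mul_pos hε hpos]
  · obtain ⟨k, rfl⟩ := Nat.exists_eq_add_of_le' hj
    rw [show k + 3 - 1 = k + 2 by omega] at hmem ⊢
    rw [hrec (k + 3) (by omega), hrec (k + 2) (by omega), show k + 3 - 1 = k + 1 + 1 by omega,
      show k + 2 - 1 = k + 1 by omega, Finset.prod_Icc_succ_top (by omega), gt_iff_lt,
      ← mul_div_assoc]
    apply div_lt_div_of_pos_right _ hs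
    set P := ∏ l ∈ Finset.Icc 1 (k + 1), (2 - α l) / 2
    have hPpos : 0 < P := Finset.prod_pos fun l hl => by
      rw [Finset.mem_Icc] at hl
      linarith [(hmem l hl.1 (by omega)).2]
    have hα : 0 < α (k + 1 + 1) := (hmem (k + 2) (by omega) le_rfl).1
    have hgap : 0 < (1 + ε) * 2 ^ (k + 1) * (Real.cos δ * (P * α (k + 1 + 1))) := by positivity
    rw [pow_succ 2 (k + 1)]
    linarith
end
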